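/- arXiv:2108.10846 — 2 statements merged into one kernel-verified Lean document; each statement's English description precedes it below -/
import Mathlib

section
/- Let A, B, C, r ∈ ℝ with B > 0 and Δ := 4BC - A² > 0, and let x₀, y₀ ∈ ℝ. Define, for t > 0 and (x,y) ∈ ℝ², u(x,y,t) = (e^{-rt - x₀ - y₀}/(2πt√Δ)) exp[ -(B/(Δt)) ( (A/(2B))(x-x₀) - (y-y₀) )² - (x-x₀)²/(4Bt) ]. Then u satisfies the constant-coefficient parabolic equation ∂u/∂t = A ∂²u/∂x∂y + B ∂²u/∂x² + C ∂²u/∂y² - r u at every point with t > 0. -/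
open Real

theorem stmt_3 (A B C r : ℝ) (hB : 0 < B) (hΔ : 0 < 4 * B * C - A ^ 2)
    (x₀ y₀ : ℝ) (u : ℝ → ℝ → ℝ → ℝ)
    (hu : ∀ x y t, u x y t =
      Real.exp (-r * t - x₀ - y₀) / (2 * Real.pi * t * Real.sqrt (4 * B * C - A ^ 2)) *
        Real.exp (-(B / ((4 * B * C - A ^ 2) * t)) *
            ((A / (2 * B)) * (x - x₀) - (y - y₀)) ^ 2
          - (x - x₀) ^ 2 / (4 * B * t))) :
    ∀ x y t, 0 < t →
      deriv (fun s => u x y s) t =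
        A * deriv (fun x' => deriv (fun y' => u x' y' t) y) x
        + B * deriv (deriv (fun x' => u x' y t)) x
        + C * deriv (deriv (fun y' => u x y' t)) y
        - r * u x y t := by
  obtain ⟨D, hD⟩ : ∃ D, D = 4 * B * C - A ^ 2 := ⟨_, rfl⟩
  have hD0 : 0 < D := hD ▸ hΔ
  obtain ⟨K, hK⟩ : ∃ K, K = Real.exp (- x₀ - y₀) / (2 * Real.pi * Real.sqrt D) := ⟨_, rfl⟩
  have hs : 0 < Real.sqrt D := Real.sqrt_pos.mpr hD0
  have hpi := Real.pi_pos
  have hu2 : ∀ x y t, 0 < t → u x y t = K / t * Real.exp (-r * t -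
      (C * (x - x₀) ^ 2 - A * (x - x₀) * (y - y₀) + B * (y - y₀) ^ 2) / (D * t)) := by
    intro x y t ht
    rw [hu, ← hD, hK]
    have e1 : -(B / (D * t)) * ((A / (2 * B)) * (x - x₀) - (y - y₀)) ^ 2
        - (x - x₀) ^ 2 / (4 * B * t) =
        -((C * (x - x₀) ^ 2 - A * (x - x₀) * (y - y₀) + B * (y - y₀) ^ 2) / (D * t)) := by
      have hC : C = (D + A ^ 2) / (4 * B) := by field_simp; linarith
      rw [hC]
      field_simp
      ring
    rw [e1, show -r * t - x₀ - y₀ = (-r * t) + (- x₀ - y₀) by ring, Real.exp_add,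
      sub_eq_add_neg (-r * t), Real.exp_add (-r * t)]
    field_simp
  clear hu
  intro x y t ht
  have hx : ∀ x y, HasDerivAt (fun x' => u x' y t)
      (u x y t * (-(2 * C * (x - x₀) - A * (y - y₀)) / (D * t))) x := by
    intro x y
    simp only [hu2 _ _ t ht]
    have h0 : HasDerivAt (fun x' : ℝ => x' - x₀) 1 x := (hasDerivAt_id x).sub_const _
    have h := ((((((((h0.pow 2).const_mul C).sub ((h0.const_mul A).mul_const (y - y₀))).add_const
      (B * (y - y₀) ^ 2)).div_const (D * t)).const_sub (-r * t)).exp).const_mul (K / t))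
    refine h.congr_deriv ?_
    simp
    ring
  have hy : ∀ x y, HasDerivAt (fun y' => u x y' t)
      (u x y t * (-(2 * B * (y - y₀) - A * (x - x₀)) / (D * t))) y := by
    intro x y
    simp only [hu2 _ _ t ht]
    have h0 : HasDerivAt (fun x' : ℝ => x' - y₀) 1 y := (hasDerivAt_id y).sub_const _
    have h := (((((((h0.const_mul (A * (x - x₀))).const_sub (C * (x - x₀) ^ 2)).add
      ((h0.pow 2).const_mul B)).div_const (D * t)).const_sub (-r * t)).exp).const_mul (K / t))
    refine h.congr_deriv ?_
    simp
    ring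
  have hT : HasDerivAt (fun s => u x y s) (u x y t * (-r - 1 / t +
      (C * (x - x₀) ^ 2 - A * (x - x₀) * (y - y₀) + B * (y - y₀) ^ 2) / (D * t ^ 2))) t := by
    have h0 : HasDerivAt (fun s : ℝ => s) 1 t := hasDerivAt_id t
    have h1 := (hasDerivAt_const t K).div h0 ht.ne'
    have h2 := (h0.const_mul (-r)).sub ((hasDerivAt_const t
      (C * (x - x₀) ^ 2 - A * (x - x₀) * (y - y₀) + B * (y - y₀) ^ 2)).div
      (h0.const_mul D) (by positivity))
    have h3 := h1.mul h2.exp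
    have h4 := h3.congr_of_eventuallyEq (f₁ := fun s => u x y s) (by
      filter_upwards [lt_mem_nhds ht] with s hs
      exact hu2 x y s hs)
    refine h4.congr_deriv ?_
    rw [hu2 x y t ht]
    simp
    field_simp
    ring
  have dx : (deriv fun x' => u x' y t) = fun x => u x y t *
      (-(2 * C * (x - x₀) - A * (y - y₀)) / (D * t)) := funext fun x => (hx x y).deriv
  have dy : ∀ x, (deriv fun y' => u x y' t) = fun y => u x y t *
      (-(2 * B * (y - y₀) - A * (x - x₀)) / (D * t)) := fun x => funext fun y => (hy x y).deriv
  have lx : HasDerivAt (fun x' : ℝ => x' - x₀) 1 x := (hasDerivAt_id x).sub_const _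
  have ly : HasDerivAt (fun x' : ℝ => x' - y₀) 1 y := (hasDerivAt_id y).sub_const _
  have hxx := ((hx x y).fun_mul
    ((((lx.const_mul (2 * C)).sub_const (A * (y - y₀))).fun_neg).div_const (D * t))).deriv
  have hyy := ((hy x y).fun_mul
    ((((ly.const_mul (2 * B)).sub_const (A * (x - x₀))).fun_neg).div_const (D * t))).deriv
  have hxy := ((hx x y).fun_mul
    ((((lx.const_mul A).const_sub (2 * B * (y - y₀))).fun_neg).div_const (D * t))).deriv
  rw [hT.deriv, dx]
  simp only [dy]
  rw [hxx, hyy, hxy]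
  generalize u x y t = U
  generalize x - x₀ = X
  generalize y - y₀ = Y
  field_simp
  rw [hD]
  ring
end

section
/- Let A, B, C, r ∈ ℝ with B > 0 and Δ := 4BC - A² > 0, and let x₀, y₀ > 0. Define, for x, y, t > 0, u(x,y,t) = (1/(2π√Δ)) (e^{-rt}/(x₀ y₀ t)) exp[ -(B/(Δt)) ( (A/(2B)) log(x/x₀) - log(y/y₀) )² - (log²(x/x₀))/(4Bt) ]. Then u satisfies the variable-coefficient parabolic equation ∂u/∂t = A x y ∂²u/∂x∂y + B x² ∂²u/∂x² + C y² ∂²u/∂y² - r u + B x ∂u/∂x + C y ∂u/∂y at every point with x, y, t > 0. -/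
open Real

lemma aux_log (x x₀ : ℝ) (hx : 0 < x) (hx₀ : 0 < x₀) :
    HasDerivAt (fun x' => Real.log (x' / x₀)) (1 / x) x := by
  have h := ((hasDerivAt_id x).div_const x₀).log (by simp; exact ⟨hx.ne', hx₀.ne'⟩)
  refine h.congr_deriv ?_
  simp only [id]
  field_simp

lemma aux_one (K a b c x x₀ : ℝ) (hx : 0 < x) (hx₀ : 0 < x₀) :
    HasDerivAt (fun x' => K * Real.exp (a * Real.log (x' / x₀) ^ 2 + b * Real.log (x' / x₀) + c))
      (K * Real.exp (a * Real.log (x / x₀) ^ 2 + b * Real.log (x / x₀) + c) *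
        ((2 * a * Real.log (x / x₀) + b) / x)) x := by
  have hl := aux_log x x₀ hx hx₀
  have h := (((((hl.pow 2).const_mul a).add (hl.const_mul b)).add_const c).exp).const_mul K
  refine h.congr_deriv ?_
  simp
  field_simp

lemma aux_lin (K a b c p q x x₀ : ℝ) (hx : 0 < x) (hx₀ : 0 < x₀) :
    HasDerivAt (fun x' => K * Real.exp (a * Real.log (x' / x₀) ^ 2 + b * Real.log (x' / x₀) + c) *
        (p * Real.log (x' / x₀) + q))
      (K * Real.exp (a * Real.log (x / x₀) ^ 2 + b * Real.log (x / x₀) + c) *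
        (((2 * a * Real.log (x / x₀) + b) * (p * Real.log (x / x₀) + q) + p) / x)) x := by
  have hl := aux_log x x₀ hx hx₀
  have h := (aux_one K a b c x x₀ hx hx₀).mul ((hl.const_mul p).add_const q)
  refine h.congr_deriv ?_
  field_simp

lemma aux_two (K a b c x x₀ : ℝ) (hx : 0 < x) (hx₀ : 0 < x₀) :
    deriv (deriv (fun x' => K * Real.exp (a * Real.log (x' / x₀) ^ 2 + b * Real.log (x' / x₀) + c))) x
     = K * Real.exp (a * Real.log (x / x₀) ^ 2 + b * Real.log (x / x₀) + c) *
        (((2 * a * Real.log (x / x₀) + b) ^ 2 + 2 * a - (2 * a * Real.log (x / x₀) + b)) / x ^ 2) := by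
  have he : deriv (fun x' => K * Real.exp (a * Real.log (x' / x₀) ^ 2 + b * Real.log (x' / x₀) + c))
      =ᶠ[nhds x] fun x' => (K * Real.exp (a * Real.log (x' / x₀) ^ 2 + b * Real.log (x' / x₀) + c) *
        (2 * a * Real.log (x' / x₀) + b)) / x' := by
    filter_upwards [lt_mem_nhds hx] with z hz
    rw [(aux_one K a b c z x₀ hz hx₀).deriv]
    ring
  rw [he.deriv_eq]
  have h := (aux_lin K a b c (2 * a) b x x₀ hx hx₀).div (hasDerivAt_id x) hx.ne'
  refine h.deriv.trans ?_
  simp only [id]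
  field_simp

lemma aux_t (K r Q t : ℝ) (ht : 0 < t) :
    HasDerivAt (fun s => K * (Real.exp (-r * s) / s) * Real.exp (Q / s))
      (K * (Real.exp (-r * t) / t) * Real.exp (Q / t) * (-r - 1 / t - Q / t ^ 2)) t := by
  have h1 := ((hasDerivAt_id t).const_mul (-r)).exp
  have h2 := (h1.div (hasDerivAt_id t) ht.ne').const_mul K
  have h3 := (((hasDerivAt_const t Q).div (hasDerivAt_id t) ht.ne')).exp
  have h := h2.mul h3
  refine h.congr_deriv ?_
  simp
  field_simp
  ring

theorem stmt_4 (A B C r : ℝ) (hB : 0 < B) (hΔ : 0 < 4 * B * C - A ^ 2)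
    (x₀ y₀ : ℝ) (hx₀ : 0 < x₀) (hy₀ : 0 < y₀)
    (u : ℝ → ℝ → ℝ → ℝ)
    (hu : ∀ x y t, u x y t =
      (1 / (2 * Real.pi * Real.sqrt (4 * B * C - A ^ 2))) *
        (Real.exp (-r * t) / (x₀ * y₀ * t)) *
        Real.exp (-(B / ((4 * B * C - A ^ 2) * t)) *
            ((A / (2 * B)) * Real.log (x / x₀) - Real.log (y / y₀)) ^ 2
          - (Real.log (x / x₀)) ^ 2 / (4 * B * t))) :
    ∀ x y t, 0 < x → 0 < y → 0 < t →
      deriv (fun s => u x y s) t =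
        A * x * y * deriv (fun x' => deriv (fun y' => u x' y' t) y) x
        + B * x ^ 2 * deriv (deriv (fun x' => u x' y t)) x
        + C * y ^ 2 * deriv (deriv (fun y' => u x y' t)) y
        - r * u x y t
        + B * x * deriv (fun x' => u x' y t) x
        + C * y * deriv (fun y' => u x y' t) y := by
  intro x y t hx hy ht
  obtain ⟨D, hD⟩ : ∃ D, D = 4 * B * C - A ^ 2 := ⟨_, rfl⟩
  rw [← hD] at hΔ hu
  obtain ⟨K, hK⟩ : ∃ K, K = 1 / (2 * Real.pi * Real.sqrt D) / (x₀ * y₀) := ⟨_, rfl⟩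
  have hC : C = (D + A ^ 2) / (4 * B) := by field_simp; linarith
  have key : ∀ X Y s : ℝ, s ≠ 0 → -(B / (D * s)) * ((A / (2 * B)) * X - Y) ^ 2 - X ^ 2 / (4 * B * s)
      = (-(C * X ^ 2 - A * X * Y + B * Y ^ 2) / D) / s := by
    intro X Y s hs
    rw [hC]
    field_simp
    ring
  have hu1 : ∀ x y s, s ≠ 0 → u x y s = K * (Real.exp (-r * s) / s) *
      Real.exp ((-(C * Real.log (x / x₀) ^ 2 - A * Real.log (x / x₀) * Real.log (y / y₀)
        + B * Real.log (y / y₀) ^ 2) / D) / s) := by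
    intro x y s hs
    rw [hu, key _ _ _ hs, hK]
    congr 1
    field_simp
  have hux : ∀ x y, u x y t = K * (Real.exp (-r * t) / t) *
      Real.exp ((-C / (D * t)) * Real.log (x / x₀) ^ 2
        + (A * Real.log (y / y₀) / (D * t)) * Real.log (x / x₀)
        + (-B * Real.log (y / y₀) ^ 2 / (D * t))) := by
    intro x y
    rw [hu1 _ _ _ ht.ne']
    congr 2
    field_simp
    ring
  have huy : ∀ x y, u x y t = K * (Real.exp (-r * t) / t) *
      Real.exp ((-B / (D * t)) * Real.log (y / y₀) ^ 2
        + (A * Real.log (x / x₀) / (D * t)) * Real.log (y / y₀)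
        + (-C * Real.log (x / x₀) ^ 2 / (D * t))) := by
    intro x y
    rw [hu1 _ _ _ ht.ne']
    congr 2
    field_simp
    ring
  have dt : deriv (fun s => u x y s) t = u x y t * (-r - 1 / t -
      (-(C * Real.log (x / x₀) ^ 2 - A * Real.log (x / x₀) * Real.log (y / y₀)
        + B * Real.log (y / y₀) ^ 2) / D) / t ^ 2) := by
    rw [hu1 x y t ht.ne', ← (aux_t K r _ t ht).deriv]
    apply Filter.EventuallyEq.deriv_eq
    filter_upwards [lt_mem_nhds ht] with s hs
    exact hu1 x y s hs.ne'
  have dx : deriv (fun x' => u x' y t) x = u x y t *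
      ((2 * (-C / (D * t)) * Real.log (x / x₀) + A * Real.log (y / y₀) / (D * t)) / x) := by
    simp only [hux]
    exact (aux_one _ _ _ _ x x₀ hx hx₀).deriv
  have dxx : deriv (deriv (fun x' => u x' y t)) x = u x y t *
      (((2 * (-C / (D * t)) * Real.log (x / x₀) + A * Real.log (y / y₀) / (D * t)) ^ 2
        + 2 * (-C / (D * t))
        - (2 * (-C / (D * t)) * Real.log (x / x₀) + A * Real.log (y / y₀) / (D * t))) / x ^ 2) := by
    simp only [hux]
    exact aux_two _ _ _ _ x x₀ hx hx₀
  have dy : ∀ x, deriv (fun y' => u x y' t) y = u x y t *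
      ((2 * (-B / (D * t)) * Real.log (y / y₀) + A * Real.log (x / x₀) / (D * t)) / y) := by
    intro x
    simp only [huy]
    exact (aux_one _ _ _ _ y y₀ hy hy₀).deriv
  have dyy : deriv (deriv (fun y' => u x y' t)) y = u x y t *
      (((2 * (-B / (D * t)) * Real.log (y / y₀) + A * Real.log (x / x₀) / (D * t)) ^ 2
        + 2 * (-B / (D * t))
        - (2 * (-B / (D * t)) * Real.log (y / y₀) + A * Real.log (x / x₀) / (D * t))) / y ^ 2) := by
    simp only [huy]
    exact aux_two _ _ _ _ y y₀ hy hy₀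
  have dxy : deriv (fun x' => deriv (fun y' => u x' y' t) y) x = u x y t *
      (((2 * (-C / (D * t)) * Real.log (x / x₀) + A * Real.log (y / y₀) / (D * t)) *
        (A / (D * t) / y * Real.log (x / x₀) + 2 * (-B / (D * t)) * Real.log (y / y₀) / y)
        + A / (D * t) / y) / x) := by
    have e : (fun x' => deriv (fun y' => u x' y' t) y) = fun x' => u x' y t *
        (A / (D * t) / y * Real.log (x' / x₀) + 2 * (-B / (D * t)) * Real.log (y / y₀) / y) := by
      funext x'
      rw [dy]
      ring
    rw [e]
    simp only [hux]
    exact (aux_lin _ _ _ _ _ _ x x₀ hx hx₀).deriv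
  rw [dt, dxy, dxx, dyy, dx, dy]
  generalize u x y t = U
  generalize Real.log (x / x₀) = X
  generalize Real.log (y / y₀) = Y
  rw [hC]
  field_simp
  ring
end
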